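/- There is no three times continuously differentiable function g : [0, ∞) → ℝ satisfying the ODE 4g(η) − η⁴g(η) − 4ηg'(η) − 4η²g(η)g'(η) + 8η²g''(η) + 4η³g'''(η) = 0 for all η ≥ 0 together with g(0) = 0, g''(0) = 0 and g'(0) > 0. In other words, every such local solution fails to be global. -/

import Mathlib

theorem aux_mono (f f' : ℝ → ℝ) (b : ℝ) (hc : ContinuousOn f (Set.Icc 0 b))
    (hd : ∀ x ∈ Set.Ioo 0 b, HasDerivAt f (f' x) x) (hn : ∀ x ∈ Set.Ioo 0 b, 0 ≤ f' x) :
    ∀ x ∈ Set.Icc 0 b, f 0 ≤ f x := by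
  intro x hx
  have hm : MonotoneOn f (Set.Icc 0 b) := by
    apply monotoneOn_of_deriv_nonneg (convex_Icc 0 b) hc
    · intro y hy
      rw [interior_Icc] at hy
      exact (hd y hy).differentiableAt.differentiableWithinAt
    · intro y hy
      rw [interior_Icc] at hy
      rw [(hd y hy).deriv]
      exact hn y hy
  exact hm ⟨le_refl _, hx.1.trans hx.2⟩ hx hx.1

/-- There is no `C³` function `g : [0, ∞) → ℝ` satisfying the ODE
`4g − η⁴g − 4ηg' − 4η²gg' + 8η²g'' + 4η³g''' = 0` for all `η ≥ 0` together with
`g(0) = 0`, `g''(0) = 0` and `g'(0) > 0`: every such local solution fails to be global. -/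
theorem stmt5 (g g' g'' g''' : ℝ → ℝ)
    (hg : ∀ η ∈ Set.Ici (0 : ℝ), HasDerivWithinAt g (g' η) (Set.Ici 0) η)
    (hg' : ∀ η ∈ Set.Ici (0 : ℝ), HasDerivWithinAt g' (g'' η) (Set.Ici 0) η)
    (hg'' : ∀ η ∈ Set.Ici (0 : ℝ), HasDerivWithinAt g'' (g''' η) (Set.Ici 0) η)
    (hg''' : ContinuousOn g''' (Set.Ici 0))
    (hode : ∀ η ∈ Set.Ici (0 : ℝ),
      4 * g η - η ^ 4 * g η - 4 * η * g' η - 4 * η ^ 2 * g η * g' η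
        + 8 * η ^ 2 * g'' η + 4 * η ^ 3 * g''' η = 0)
    (h0 : g 0 = 0) (h2 : g'' 0 = 0) (h1 : 0 < g' 0) :
    False := by
  have cg : ContinuousOn g (Set.Ici 0) := fun x hx => (hg x hx).continuousWithinAt
  have cg' : ContinuousOn g' (Set.Ici 0) := fun x hx => (hg' x hx).continuousWithinAt
  have cg'' : ContinuousOn g'' (Set.Ici 0) := fun x hx => (hg'' x hx).continuousWithinAt
  have dg : ∀ x, 0 < x → HasDerivAt g (g' x) x :=
    fun x hx => (hg x hx.le).hasDerivAt (Ici_mem_nhds hx)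
  have dg' : ∀ x, 0 < x → HasDerivAt g' (g'' x) x :=
    fun x hx => (hg' x hx.le).hasDerivAt (Ici_mem_nhds hx)
  have dg'' : ∀ x, 0 < x → HasDerivAt g'' (g''' x) x :=
    fun x hx => (hg'' x hx.le).hasDerivAt (Ici_mem_nhds hx)
  -- the quotient of g by η, continuously extended to 0
  obtain ⟨φ, hφ0, hφ⟩ : ∃ φ : ℝ → ℝ, φ 0 = g' 0 ∧ ∀ x, 0 < x → φ x = g x / x :=
    ⟨fun x => if x = 0 then g' 0 else g x / x, by simp, fun x hx => by simp [hx.ne']⟩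
  have dφ : ∀ x, 0 < x → HasDerivAt φ ((g' x * x - g x * 1) / x ^ 2) x := by
    intro x hx
    refine ((dg x hx).div (hasDerivAt_id x) hx.ne').congr_of_eventuallyEq ?_
    filter_upwards [Ioi_mem_nhds hx] with y hy
    exact hφ y hy
  have cφ : ContinuousOn φ (Set.Ici 0) := by
    intro x hx
    rcases eq_or_lt_of_le (show (0 : ℝ) ≤ x from hx) with h | h
    · subst h
      have h3 := hg 0 hx
      rw [hasDerivWithinAt_iff_tendsto_slope] at h3
      rw [← continuousWithinAt_diff_self]
      unfold ContinuousWithinAt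
      rw [hφ0]
      refine h3.congr' ?_
      filter_upwards [self_mem_nhdsWithin] with y hy
      have hy0 : 0 < y := lt_of_le_of_ne hy.1 (fun h => hy.2 (by simp [← h]))
      rw [hφ y hy0, slope_def_field, h0]
      simp
    · exact (dφ x h).continuousAt.continuousWithinAt
  have key : ∀ b, 0 < b → (∀ x ∈ Set.Ioo 0 b, 0 < g x) → ∀ x ∈ Set.Icc 0 b,
      0 ≤ x * g'' x + g' x - φ x - g x ^ 2 / 2 ∧ 2 * g' 0 ≤ g' x + φ x ∧
        g' 0 * x ^ 2 ≤ x * g x := by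
    intro b hb hpos
    have hsub : Set.Icc 0 b ⊆ Set.Ici (0 : ℝ) := fun x hx => hx.1
    have c0 := cg.mono hsub
    have c1 := cg'.mono hsub
    have c2 := cg''.mono hsub
    have c3 := cφ.mono hsub
    have A : ∀ x ∈ Set.Icc 0 b, 0 ≤ x * g'' x + g' x - φ x - g x ^ 2 / 2 := by
      have := aux_mono (fun x => x * g'' x + g' x - φ x - g x ^ 2 / 2)
        (fun x => x ^ 2 * g x / 4) b (by fun_prop) ?_ ?_
      · intro x hx
        have h := this x hx
        simp only [h0, hφ0] at h
        linarith
      · intro x hx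
        have hx0 := hx.1
        have hd := ((((hasDerivAt_id x).mul (dg'' x hx0)).add (dg' x hx0)).sub (dφ x hx0)).sub
          (((dg x hx0).pow 2).div_const 2)
        refine hd.congr_deriv ?_
        have ho := hode x hx0.le
        simp only [id]
        field_simp
        push_cast
        linarith
      · intro x hx
        have := hpos x hx
        positivity
    have B : ∀ x ∈ Set.Icc 0 b, 2 * g' 0 ≤ g' x + φ x := by
      have := aux_mono (fun x => g' x + φ x)
        (fun x => g'' x + (g' x * x - g x * 1) / x ^ 2) b (by fun_prop) ?_ ?_
      · intro x hx
        have h := this x hx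
        simp only [hφ0] at h
        linarith
      · intro x hx
        exact (dg' x hx.1).add (dφ x hx.1)
      · intro x hx
        have hx0 := hx.1
        have h := A x ⟨hx.1.le, hx.2.le⟩
        rw [hφ x hx0] at h
        have e : g'' x + (g' x * x - g x * 1) / x ^ 2 = (x * g'' x + g' x - g x / x) / x := by
          field_simp
          ring
        rw [e]
        apply div_nonneg _ hx0.le
        nlinarith [sq_nonneg (g x)]
    have C : ∀ x ∈ Set.Icc 0 b, g' 0 * x ^ 2 ≤ x * g x := by
      have := aux_mono (fun x => x * g x - g' 0 * x ^ 2)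
        (fun x => x * (g' x + φ x - 2 * g' 0)) b (by fun_prop) ?_ ?_
      · intro x hx
        have h := this x hx
        simp only [h0] at h
        linarith
      · intro x hx
        have hx0 := hx.1
        have hd := ((hasDerivAt_id x).mul (dg x hx0)).sub
          (((hasDerivAt_id x).pow 2).const_mul (g' 0))
        refine hd.congr_deriv ?_
        rw [hφ x hx0]
        simp only [id]
        field_simp
        push_cast
        ring
      · intro x hx
        have h := B x ⟨hx.1.le, hx.2.le⟩
        exact mul_nonneg hx.1.le (by linarith)
    exact fun x hx => ⟨A x hx, B x hx, C x hx⟩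
  have gpos : ∀ c, 0 < c → 0 < g c := by
    intro c hc
    by_contra hneg
    push Not at hneg
    have hev : ∀ᶠ x in nhdsWithin 0 (Set.Ici (0 : ℝ)), 0 < φ x :=
      (cφ 0 (by simp)).eventually (lt_mem_nhds (by rw [hφ0]; exact h1))
    obtain ⟨δ, hδ, hδs⟩ := mem_nhdsGE_iff_exists_Ico_subset.1 hev
    have hδ0 : 0 < δ := hδ
    have hsm : ∀ x, 0 < x → x < δ → 0 < g x := by
      intro x hx hxd
      have h : 0 < φ x := hδs ⟨hx.le, hxd⟩
      rw [hφ x hx] at h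
      exact (div_pos_iff_of_pos_right hx).1 h
    have hdc : δ ≤ c := by
      by_contra h
      push Not at h
      linarith [hsm c hc h]
    have hcl : IsClosed (Set.Icc δ c ∩ g ⁻¹' Set.Iic 0) :=
      (cg.mono (fun x hx => hδ0.le.trans hx.1)).preimage_isClosed_of_isClosed isClosed_Icc
        isClosed_Iic
    have hcomp : IsCompact (Set.Icc δ c ∩ g ⁻¹' Set.Iic 0) :=
      isCompact_Icc.of_isClosed_subset hcl Set.inter_subset_left
    obtain ⟨b, hb, hmin⟩ := hcomp.exists_isLeast ⟨c, ⟨hdc, le_refl c⟩, hneg⟩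
    have hb0 : 0 < b := hδ0.trans_le hb.1.1
    have hC := (key b hb0 (by
      intro x hx
      by_contra h
      push Not at h
      by_cases hxd : x < δ
      · linarith [hsm x hx.1 hxd]
      · push Not at hxd
        have := hmin ⟨⟨hxd, hx.2.le.trans hb.1.2⟩, h⟩
        linarith [hx.2]) b ⟨hb0.le, le_refl b⟩).2.2
    have hgb : g b ≤ 0 := hb.2
    have : 0 < g' 0 * b ^ 2 := by positivity
    nlinarith
  have all : ∀ x, 0 < x → x * g x ^ 2 / 2 ≤ x ^ 2 * g'' x + x * g' x - g x ∧
      0 < g x + x * g' x := by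
    intro x hx
    obtain ⟨hA, hB, -⟩ := key x hx (fun y hy => gpos y hy.1) x ⟨hx.le, le_refl x⟩
    rw [hφ x hx] at hA hB
    have hA' := mul_nonneg hx.le hA
    have e1 : x * (x * g'' x + g' x - g x / x - g x ^ 2 / 2)
      = x ^ 2 * g'' x + x * g' x - g x - x * g x ^ 2 / 2 := by
      field_simp
    have hB' : 0 < x * (g' x + g x / x) := mul_pos hx (by linarith)
    have e2 : x * (g' x + g x / x) = g x + x * g' x := by
      field_simp
      ring
    rw [e1] at hA'
    rw [e2] at hB'
    exact ⟨by linarith, hB'⟩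
  have energy : ∀ b, 0 < b → (b * g b) ^ 3 / 3 ≤ (b * g b + b ^ 2 * g' b) ^ 2 := by
    intro b hb
    have hsub : Set.Icc 0 b ⊆ Set.Ici (0 : ℝ) := fun x hx => hx.1
    have c0 := cg.mono hsub
    have c1 := cg'.mono hsub
    have := aux_mono (fun x => (x * g x + x ^ 2 * g' x) ^ 2 - (x * g x) ^ 3 / 3)
      (fun x => (g x + x * g' x) *
        (2 * (x * (g x + 3 * x * g' x + x ^ 2 * g'' x)) - (x * g x) ^ 2)) b (by fun_prop) ?_ ?_
      b ⟨hb.le, le_refl b⟩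
    · simp at this
      linarith
    · intro x hx
      have hx0 := hx.1
      have hP := (hasDerivAt_id x).mul (dg x hx0)
      have hd := ((hP.add (((hasDerivAt_id x).pow 2).mul (dg' x hx0))).pow 2).sub
        ((hP.pow 3).div_const 3)
      refine hd.congr_deriv ?_
      simp [id]
      ring
    · intro x hx
      have hx0 := hx.1
      obtain ⟨h3, h4⟩ := all x hx0
      apply mul_nonneg h4.le
      have h5 := mul_le_mul_of_nonneg_left h3 hx0.le
      have h6 := mul_pos hx0 h4
      nlinarith
  -- final blow-up
  have Ppos : ∀ x, 0 < x → 0 < x * g x := fun x hx => mul_pos hx (gpos x hx)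
  have dF : ∀ x, 0 < x → HasDerivAt (fun x => (Real.sqrt (x * g x))⁻¹ + 1 / 4 * Real.log x)
      (-((g x + x * g' x) / (2 * Real.sqrt (x * g x))) / (Real.sqrt (x * g x)) ^ 2
        + 1 / 4 * x⁻¹) x := by
    intro x hx
    have hP : HasDerivAt (fun x => x * g x) (g x + x * g' x) x := by
      refine ((hasDerivAt_id x).mul (dg x hx)).congr_deriv ?_
      simp
    have hs := hP.sqrt (Ppos x hx).ne'
    exact (hs.inv (Real.sqrt_pos.2 (Ppos x hx)).ne').add
      ((Real.hasDerivAt_log hx.ne').const_mul (1 / 4))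
  have anti : AntitoneOn (fun x => (Real.sqrt (x * g x))⁻¹ + 1 / 4 * Real.log x)
      (Set.Ici (1 : ℝ)) := by
    apply antitoneOn_of_deriv_nonpos (convex_Ici 1)
    · intro x hx
      exact (dF x (lt_of_lt_of_le one_pos hx)).continuousAt.continuousWithinAt
    · intro x hx
      rw [interior_Ici] at hx
      exact (dF x (one_pos.trans hx)).differentiableAt.differentiableWithinAt
    · intro x hx
      rw [interior_Ici] at hx
      have hx0 : 0 < x := one_pos.trans hx
      rw [(dF x hx0).deriv]
      have hs0 : 0 < Real.sqrt (x * g x) := Real.sqrt_pos.2 (Ppos x hx0)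
      have hsq : Real.sqrt (x * g x) ^ 2 = x * g x := Real.sq_sqrt (Ppos x hx0).le
      have he := energy x hx0
      rw [← hsq] at he
      have hq := (all x hx0).2
      set s := Real.sqrt (x * g x)
      have hmain : s ^ 3 / 2 ≤ x * (g x + x * g' x) := by
        refine (pow_le_pow_iff_left₀ (by positivity) (mul_pos hx0 hq).le two_ne_zero).1 ?_
        have e : (s ^ 2 + x ^ 2 * g' x) ^ 2 = (x * (g x + x * g' x)) ^ 2 := by
          rw [hsq]
          ring
        rw [e] at he
        have : 0 < s ^ 6 := by positivity
        nlinarith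
      have e2 : -((g x + x * g' x) / (2 * s)) / s ^ 2 + 1 / 4 * x⁻¹
          = (s ^ 3 / 2 - x * (g x + x * g' x)) / (2 * s ^ 3 * x) := by
        field_simp
        ring
      rw [e2]
      exact div_nonpos_of_nonpos_of_nonneg (by linarith) (by positivity)
  set F1 := (Real.sqrt (1 * g 1))⁻¹ with hF1
  have hF1pos : 0 ≤ F1 := by positivity
  have hx1 : 1 ≤ Real.exp (4 * F1) := Real.one_le_exp (by positivity)
  have hfin := anti (Set.mem_Ici.2 (le_refl 1)) (Set.mem_Ici.2 hx1) hx1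
  have hp : 0 < (Real.sqrt (Real.exp (4 * F1) * g (Real.exp (4 * F1))))⁻¹ :=
    inv_pos.2 (Real.sqrt_pos.2 (Ppos _ (Real.exp_pos _)))
  simp only [Real.log_exp, Real.log_one] at hfin
  linarith
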